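/- arXiv:2005.13664 — 2 statements merged into one kernel-verified Lean document; each statement's English description precedes it below -/
import Mathlib

section
/- Let Φ be a smooth circle action on an open set U ⊆ ℝ³ with infinitesimal generator u and averaged metric ḡ, and define R²(x) = ⟨u(x), ḡ(x)u(x)⟩. Then the directional derivative of R² along u vanishes: ⟨∇R²(x), u(x)⟩ = 0 for every x ∈ U. -/
open Matrix MeasureTheory
open scoped Real

noncomputable section

/-- Vectors in ℝ³. -/
abbrev V3 := Fin 3 → ℝ

/-- Partial derivative of a scalar field in the `i`-th coordinate direction. -/
def pd (i : Fin 3) (f : V3 → ℝ) (x : V3) : ℝ := fderiv ℝ f x (Pi.single i 1)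

/-- Gradient of a scalar field, componentwise from partial derivatives. -/
def grad (f : V3 → ℝ) (x : V3) : V3 := fun i => pd i f x

/-- Curl of a vector field, componentwise from partial derivatives. -/
def curl (w : V3 → V3) (x : V3) : V3 :=
  ![pd 1 (fun y => w y 2) x - pd 2 (fun y => w y 1) x,
    pd 2 (fun y => w y 0) x - pd 0 (fun y => w y 2) x,
    pd 0 (fun y => w y 1) x - pd 1 (fun y => w y 0) x]

/-- Divergence of a vector field. -/
def div3 (w : V3 → V3) (x : V3) : ℝ := ∑ i, pd i (fun y => w y i) x

/-- Jacobian matrix of a map `f : ℝ³ → ℝ³` at `x`. -/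
def jacobian (f : V3 → V3) (x : V3) : Matrix (Fin 3) (Fin 3) ℝ :=
  Matrix.of fun i j => pd j (fun y => f y i) x

/-- A smooth circle action on a set `U ⊆ ℝ³`. -/
structure SmoothCircleAction (U : Set V3) where
  act : ℝ → V3 → V3
  smooth : ContDiffOn ℝ (⊤ : ℕ∞) (fun p : ℝ × V3 => act p.1 p.2) (Set.univ ×ˢ U)
  mapsTo : ∀ θ : ℝ, Set.MapsTo (act θ) U U
  periodic : ∀ θ : ℝ, ∀ x ∈ U, act (θ + 2 * π) x = act θ x
  act_zero : ∀ x ∈ U, act 0 x = x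
  act_add : ∀ θ₁ θ₂ : ℝ, ∀ x ∈ U, act (θ₁ + θ₂) x = act θ₁ (act θ₂ x)

/-- Infinitesimal generator of a circle action. -/
def gen (Φ : ℝ → V3 → V3) (x : V3) : V3 := deriv (fun θ => Φ θ x) 0

/-- The action is volume preserving: the Jacobian determinant is `1`. -/
def VolumePreserving (U : Set V3) (Φ : ℝ → V3 → V3) : Prop :=
  ∀ θ : ℝ, ∀ x ∈ U, (jacobian (Φ θ) x).det = 1

/-- The action preserves (pushes forward) the vector field `w`. -/
def PreservesVec (U : Set V3) (Φ : ℝ → V3 → V3) (w : V3 → V3) : Prop :=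
  ∀ θ : ℝ, ∀ x ∈ U, (jacobian (Φ θ) x).mulVec (w x) = w (Φ θ x)

/-- The action preserves the scalar field `f`. -/
def PreservesFn (U : Set V3) (Φ : ℝ → V3 → V3) (f : V3 → ℝ) : Prop :=
  ∀ θ : ℝ, ∀ x ∈ U, f (Φ θ x) = f x

/-- The averaged metric `ḡ(x) = (1/2π)∫₀^{2π} DΦ_θ(x)ᵀ DΦ_θ(x) dθ`, entrywise. -/
def avgMetric (Φ : ℝ → V3 → V3) (x : V3) : Matrix (Fin 3) (Fin 3) ℝ :=
  Matrix.of fun i j =>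
    (1 / (2 * π)) * ∫ θ in (0:ℝ)..(2 * π), ((jacobian (Φ θ) x)ᵀ * jacobian (Φ θ) x) i j

/-- The averaged covector field `Ā(x) = (1/2π)∫₀^{2π} DΦ_θ(x)ᵀ A(Φ_θ(x)) dθ`, componentwise. -/
def avgCov (Φ : ℝ → V3 → V3) (A : V3 → V3) (x : V3) : V3 :=
  fun i => (1 / (2 * π)) * ∫ θ in (0:ℝ)..(2 * π), (jacobian (Φ θ) x)ᵀ.mulVec (A (Φ θ x)) i


lemma jacobian_mulVec {f : V3 → V3} {x : V3} (hf : DifferentiableAt ℝ f x) (v : V3) :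
    (jacobian f x).mulVec v = fderiv ℝ f x v := by
  ext i
  have hv : v = ∑ j, v j • (Pi.single j 1 : V3) := by
    ext k
    simp [Finset.sum_apply, Pi.single_apply]
  conv_rhs => rw [hv]
  simp only [map_sum, map_smul, Finset.sum_apply, Pi.smul_apply, smul_eq_mul]
  simp only [mulVec, dotProduct, jacobian, pd, of_apply]
  refine Finset.sum_congr rfl fun j _ => ?_
  rw [fderiv_apply hf, mul_comm]
  simp

lemma grad_dotProduct (f : V3 → ℝ) (x v : V3) : grad f x ⬝ᵥ v = fderiv ℝ f x v := by
  have hv : v = ∑ j, v j • (Pi.single j 1 : V3) := by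
    ext k
    simp [Finset.sum_apply, Pi.single_apply]
  conv_rhs => rw [hv]
  simp only [map_sum, map_smul, smul_eq_mul, dotProduct, grad, pd]
  exact Finset.sum_congr rfl fun j _ => mul_comm _ _

namespace SmoothCircleAction

variable {U : Set V3}

lemma contDiffAt_uncurry (hU : IsOpen U) (Φ : SmoothCircleAction U) (θ : ℝ) {x : V3}
    (hx : x ∈ U) : ContDiffAt ℝ (⊤ : ℕ∞) (fun p : ℝ × V3 => Φ.act p.1 p.2) (θ, x) :=
  Φ.smooth.contDiffAt ((isOpen_univ.prod hU).mem_nhds ⟨Set.mem_univ _, hx⟩)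

lemma hasFDerivAt_act (hU : IsOpen U) (Φ : SmoothCircleAction U) (θ : ℝ) {x : V3}
    (hx : x ∈ U) :
    HasFDerivAt (Φ.act θ) ((fderiv ℝ (fun p : ℝ × V3 => Φ.act p.1 p.2) (θ, x)).comp
      (ContinuousLinearMap.inr ℝ ℝ V3)) x :=
  ((Φ.contDiffAt_uncurry hU θ hx).differentiableAt (by simp)).hasFDerivAt.comp x
    (hasFDerivAt_prodMk_right θ x)

lemma differentiableAt_orbit (hU : IsOpen U) (Φ : SmoothCircleAction U) (θ : ℝ) {x : V3}
    (hx : x ∈ U) : DifferentiableAt ℝ (fun s => Φ.act s x) θ :=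
  DifferentiableAt.comp (f := fun s : ℝ => (s, x)) θ
    ((Φ.contDiffAt_uncurry hU θ hx).differentiableAt (by simp))
    (hasFDerivAt_prodMk_left θ x).differentiableAt

lemma hasDerivAt_orbit_zero (hU : IsOpen U) (Φ : SmoothCircleAction U) {x : V3}
    (hx : x ∈ U) : HasDerivAt (fun s => Φ.act s x) (gen Φ.act x) 0 :=
  (Φ.differentiableAt_orbit hU 0 hx).hasDerivAt

lemma continuous_jacobian (hU : IsOpen U) (Φ : SmoothCircleAction U) {x : V3} (hx : x ∈ U) :
    Continuous fun θ => jacobian (Φ.act θ) x := by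
  have hc : Continuous fun θ : ℝ => fderiv ℝ (fun p : ℝ × V3 => Φ.act p.1 p.2) (θ, x) :=
    (Φ.smooth.continuousOn_fderiv_of_isOpen (isOpen_univ.prod hU) (by simp)).comp_continuous
      (by fun_prop) fun θ => ⟨Set.mem_univ _, hx⟩
  refine continuous_matrix fun i j => ?_
  have h : (fun θ => jacobian (Φ.act θ) x i j) = fun θ =>
      fderiv ℝ (fun p : ℝ × V3 => Φ.act p.1 p.2) (θ, x) (0, Pi.single j 1) i := by
    funext θ
    have hd := Φ.hasFDerivAt_act hU θ hx
    simp only [jacobian, pd, of_apply]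
    rw [fderiv_apply hd.differentiableAt, hd.fderiv]
    simp
  rw [h]
  fun_prop

/-- The generator is invariant under the action it generates. -/
lemma preservesVec_gen (hU : IsOpen U) (Φ : SmoothCircleAction U) :
    PreservesVec U Φ.act (gen Φ.act) := by
  intro θ x hx
  have hd := (Φ.hasFDerivAt_act hU θ hx).differentiableAt
  rw [jacobian_mulVec hd]
  have h₁ : HasDerivAt (fun s => Φ.act θ (Φ.act s x))
      (fderiv ℝ (Φ.act θ) x (gen Φ.act x)) 0 :=
    HasFDerivAt.comp_hasDerivAt_of_eq 0 hd.hasFDerivAt (Φ.hasDerivAt_orbit_zero hU hx)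
      (Φ.act_zero x hx).symm
  have h₂ : (fun s => Φ.act θ (Φ.act s x)) = fun s => Φ.act s (Φ.act θ x) := by
    funext s
    rw [← Φ.act_add θ s x hx, ← Φ.act_add s θ x hx, add_comm]
  rw [h₂] at h₁
  exact h₁.unique (Φ.hasDerivAt_orbit_zero hU (Φ.mapsTo θ hx))

/-- The averaged metric evaluated on a vector is the average of the pulled-back quadratic form. -/
lemma dotProduct_avgMetric_mulVec (hU : IsOpen U) (Φ : SmoothCircleAction U) {x : V3}
    (hx : x ∈ U) (v : V3) :
    v ⬝ᵥ (avgMetric Φ.act x).mulVec v = (1 / (2 * π)) * ∫ θ in (0 : ℝ)..(2 * π),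
      (jacobian (Φ.act θ) x).mulVec v ⬝ᵥ (jacobian (Φ.act θ) x).mulVec v := by
  have hc := Φ.continuous_jacobian hU hx
  have hint : ∀ i j, Continuous fun θ =>
      ((jacobian (Φ.act θ) x)ᵀ * jacobian (Φ.act θ) x) i j := fun i j =>
    (hc.matrix_transpose.matrix_mul hc).matrix_elem i j
  have h : ∀ θ, (jacobian (Φ.act θ) x).mulVec v ⬝ᵥ (jacobian (Φ.act θ) x).mulVec v =
      ∑ i, ∑ j, v i * (((jacobian (Φ.act θ) x)ᵀ * jacobian (Φ.act θ) x) i j * v j) := by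
    intro θ
    rw [dotProduct_mulVec, ← mulVec_transpose, mulVec_mulVec, dotProduct_comm]
    simp only [dotProduct, mulVec, Finset.mul_sum]
  simp only [h]
  rw [intervalIntegral.integral_finsetSum fun i _ => Continuous.intervalIntegrable
    (continuous_finsetSum _ fun j _ => ((hint i j).mul_const _).const_mul _) _ _]
  simp only [dotProduct, mulVec, avgMetric, of_apply, Finset.mul_sum]
  refine Finset.sum_congr rfl fun i _ => ?_
  rw [intervalIntegral.integral_finsetSum fun j _ => Continuous.intervalIntegrable
    (((hint i j).mul_const _).const_mul _) _ _, Finset.mul_sum]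
  refine Finset.sum_congr rfl fun j _ => ?_
  rw [intervalIntegral.integral_const_mul, intervalIntegral.integral_mul_const]
  ring

lemma preservesFn_gen_avgMetric (hU : IsOpen U) (Φ : SmoothCircleAction U) :
    PreservesFn U Φ.act
      fun x => gen Φ.act x ⬝ᵥ (avgMetric Φ.act x).mulVec (gen Φ.act x) := by
  intro s x hx
  have hs := Φ.mapsTo s hx
  simp only [Φ.dotProduct_avgMetric_mulVec hU hs, Φ.dotProduct_avgMetric_mulVec hU hx,
    Φ.preservesVec_gen hU _ _ hs, Φ.preservesVec_gen hU _ _ hx, ← Φ.act_add _ s x hx]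
  congr 1
  have hp : Function.Periodic
      (fun θ => gen Φ.act (Φ.act θ x) ⬝ᵥ gen Φ.act (Φ.act θ x)) (2 * π) := fun θ => by
    simp only [Φ.periodic θ x hx]
  rw [intervalIntegral.integral_comp_add_right
    fun θ => gen Φ.act (Φ.act θ x) ⬝ᵥ gen Φ.act (Φ.act θ x)]
  simpa [add_comm s] using hp.intervalIntegral_add_eq s 0

/-- A scalar field preserved by the action has zero derivative along the generator. -/
lemma grad_dotProduct_gen_eq_zero (hU : IsOpen U) (Φ : SmoothCircleAction U) {f : V3 → ℝ}
    (hf : PreservesFn U Φ.act f) {x : V3} (hx : x ∈ U) : grad f x ⬝ᵥ gen Φ.act x = 0 := by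
  rw [grad_dotProduct]
  by_cases hd : DifferentiableAt ℝ f x
  · have h₁ : HasDerivAt (fun s => f (Φ.act s x)) (fderiv ℝ f x (gen Φ.act x)) 0 :=
      HasFDerivAt.comp_hasDerivAt_of_eq 0 hd.hasFDerivAt (Φ.hasDerivAt_orbit_zero hU hx)
        (Φ.act_zero x hx).symm
    simp only [hf _ x hx] at h₁
    exact h₁.unique (hasDerivAt_const _ _)
  · simp [fderiv_zero_of_not_differentiableAt hd]

end SmoothCircleAction

/-- first structure equation, `u ·̄ ∇̄R² = 0`. -/
theorem structure_equation_R2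
    (U : Set V3) (hU : IsOpen U) (Φ : SmoothCircleAction U)
    (u : V3 → V3) (hu : u = gen Φ.act)
    (g : V3 → Matrix (Fin 3) (Fin 3) ℝ) (hg : g = avgMetric Φ.act)
    (R2 : V3 → ℝ) (hR2 : ∀ x, R2 x = u x ⬝ᵥ (g x).mulVec (u x)) :
    ∀ x ∈ U, grad R2 x ⬝ᵥ u x = 0 := by
  obtain rfl : R2 = fun x => u x ⬝ᵥ (g x).mulVec (u x) := funext hR2
  subst hu hg
  intro x hx
  exact Φ.grad_dotProduct_gen_eq_zero hU (Φ.preservesFn_gen_avgMetric hU) hx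
end
end

section
/- Let Φ be a volume-preserving smooth circle action on an open set U ⊆ ℝ³. Let A : U → ℝ³ be C^∞, set B = ∇×A, and assume Φ preserves B (DΦ_θ(x)B(x) = B(Φ(θ,x)) for all θ, x). Define the averaged potential Ā(x) = (1/2π)∫₀^{2π} DΦ_θ(x)ᵀ A(Φ(θ,x)) dθ. Then ∇×Ā = B on U. -/
open Matrix MeasureTheory
open scoped Real

noncomputable section

open scoped ContDiff Topology

lemma contDiffAt_pd_param {f : ℝ → V3 → ℝ} {θ : ℝ} {x : V3} (i : Fin 3)
    (hf : ContDiffAt ℝ ∞ (fun p : ℝ × V3 => f p.1 p.2) (θ, x)) :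
    ContDiffAt ℝ ∞ (fun p : ℝ × V3 => pd i (f p.1) p.2) (θ, x) := by
  have h : ContDiffAt ℝ ∞ (Function.uncurry fun (p : ℝ × V3) (y : V3) => f p.1 y)
      ((θ, x), x) :=
    ContDiffAt.comp (g := fun p : ℝ × V3 => f p.1 p.2)
      (f := fun q : (ℝ × V3) × V3 => (q.1.1, q.2)) ((θ, x), x) hf (by fun_prop)
  exact (ContDiffAt.fderiv (m := ∞) h contDiffAt_snd (by simp)).clm_apply contDiffAt_const

lemma contDiffAt_pd {f : V3 → ℝ} {x : V3} (i : Fin 3) (hf : ContDiffAt ℝ ∞ f x) :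
    ContDiffAt ℝ ∞ (pd i f) x :=
  (hf.fderiv_right (m := ∞) (by simp)).clm_apply contDiffAt_const

lemma pd_comm {f : V3 → ℝ} {x : V3} (i j : Fin 3) (hf : ContDiffAt ℝ ∞ f x) :
    pd i (pd j f) x = pd j (pd i f) x := by
  have hd : DifferentiableAt ℝ (fderiv ℝ f) x :=
    (hf.fderiv_right (m := ∞) (by simp)).differentiableAt (by simp)
  have key (k l : Fin 3) : pd k (pd l f) x =
      fderiv ℝ (fderiv ℝ f) x (Pi.single k 1) (Pi.single l 1) := by
    have h := hd.hasFDerivAt.clm_apply (hasFDerivAt_const (Pi.single l 1 : V3) x)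
    change fderiv ℝ (fun y => fderiv ℝ f y (Pi.single l 1)) x (Pi.single k 1) = _
    rw [h.fderiv]
    simp
  rw [key, key]
  exact hf.isSymmSndFDerivAt (by simpa using ENat.LEInfty.out) _ _

lemma pd_comp {g : V3 → ℝ} {φ : V3 → V3} {x : V3} (j : Fin 3)
    (hg : DifferentiableAt ℝ g (φ x)) (hφ : DifferentiableAt ℝ φ x) :
    pd j (fun y => g (φ y)) x = ∑ l, jacobian φ x l j * pd l g (φ x) := by
  have h : fderiv ℝ φ x (Pi.single j 1) = fun l => jacobian φ x l j := by
    ext l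
    simp [jacobian, pd, (hasFDerivAt_pi'.1 hφ.hasFDerivAt l).fderiv]
  have hc := (hg.hasFDerivAt.comp x hφ.hasFDerivAt).fderiv
  simp only [pd]
  change fderiv ℝ (g ∘ φ) x _ = _
  rw [hc, ContinuousLinearMap.comp_apply, h, pi_eq_sum_univ' fun l => jacobian φ x l j, map_sum]
  refine Finset.sum_congr rfl fun l _ => ?_
  rw [map_smul, smul_eq_mul]

lemma pd_pullback {φ A : V3 → V3} {x : V3} (hφ : ContDiffAt ℝ ∞ φ x)
    (hA : ContDiffAt ℝ ∞ A (φ x)) (i j : Fin 3) :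
    pd j (fun y => (jacobian φ y)ᵀ.mulVec (A (φ y)) i) x =
      ∑ k, (pd j (pd i fun y => φ y k) x * A (φ x) k +
        jacobian φ x k i * ∑ l, jacobian φ x l j * pd l (fun y => A y k) (φ x)) := by
  have hφk (k : Fin 3) : ContDiffAt ℝ ∞ (fun y => φ y k) x := contDiffAt_pi.1 hφ k
  have hAk (k : Fin 3) : ContDiffAt ℝ ∞ (fun y => A y k) (φ x) := contDiffAt_pi.1 hA k
  have h1 (k : Fin 3) := ((contDiffAt_pd i (hφk k)).differentiableAt (by simp)).hasFDerivAt
  have h2 (k : Fin 3) :=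
    (((hAk k).comp x hφ).differentiableAt (by simp)).hasFDerivAt
  have h3 := HasFDerivAt.fun_sum (u := Finset.univ) fun k _ => (h1 k).mul (h2 k)
  have h4 : (fun y => (jacobian φ y)ᵀ.mulVec (A (φ y)) i) =
      fun y => ∑ k, (pd i (fun z => φ z k) * ((fun z => A z k) ∘ φ)) y := by
    ext y
    simp [Matrix.mulVec, dotProduct, jacobian]
  rw [h4, pd, h3.fderiv, _root_.sum_apply]
  refine Finset.sum_congr rfl fun k _ => ?_
  rw [← pd_comp j ((hAk k).differentiableAt (by simp)) (hφ.differentiableAt (by simp))]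
  simp [pd, jacobian, Function.comp_def]
  ring

lemma curl_pullback {φ A : V3 → V3} {x : V3} (hφ : ContDiffAt ℝ ∞ φ x)
    (hA : ContDiffAt ℝ ∞ A (φ x)) :
    curl (fun y => (jacobian φ y)ᵀ.mulVec (A (φ y))) x =
      (jacobian φ x).adjugate.mulVec (curl A (φ x)) := by
  have hc (k i j : Fin 3) := pd_comm i j (contDiffAt_pi.1 hφ k)
  ext i
  rw [Matrix.adjugate_fin_three]
  fin_cases i <;>
  · simp only [curl, pd_pullback hφ hA, hc _ 1 0, hc _ 2 0, hc _ 2 1]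
    simp [Fin.sum_univ_three, Matrix.mulVec, dotProduct]
    ring

lemma curl_pullback_of_preserves {φ A : V3 → V3} {x : V3} (hφ : ContDiffAt ℝ ∞ φ x)
    (hA : ContDiffAt ℝ ∞ A (φ x)) (hdet : (jacobian φ x).det = 1)
    (h : (jacobian φ x).mulVec (curl A x) = curl A (φ x)) :
    curl (fun y => (jacobian φ y)ᵀ.mulVec (A (φ y))) x = curl A x := by
  rw [curl_pullback hφ hA, ← h, Matrix.mulVec_mulVec, Matrix.adjugate_mul, hdet, one_smul,
    Matrix.one_mulVec]

lemma pd_intervalIntegral {U : Set V3} (hU : IsOpen U) {f : ℝ → V3 → ℝ} {a b : ℝ}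
    (hf : ∀ θ, ∀ x ∈ U, ContDiffAt ℝ ∞ (fun p : ℝ × V3 => f p.1 p.2) (θ, x))
    {x : V3} (hx : x ∈ U) (j : Fin 3) :
    pd j (fun y => ∫ θ in a..b, f θ y) x = ∫ θ in a..b, pd j (f θ) x := by
  have hcf (y : V3) (hy : y ∈ U) : Continuous fun θ => f θ y :=
    continuous_iff_continuousAt.2 fun θ =>
      ContinuousAt.comp (g := fun p : ℝ × V3 => f p.1 p.2) (f := fun θ => (θ, y))
        (hf θ y hy).continuousAt (by fun_prop)
  have hD (θ : ℝ) (y : V3) (hy : y ∈ U) :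
      ContinuousAt (fun p : ℝ × V3 => fderiv ℝ (f p.1) p.2) (θ, y) := by
    have h : ContDiffAt ℝ ∞ (Function.uncurry fun (p : ℝ × V3) (y : V3) => f p.1 y)
        ((θ, y), y) :=
      ContDiffAt.comp (g := fun p : ℝ × V3 => f p.1 p.2)
        (f := fun q : (ℝ × V3) × V3 => (q.1.1, q.2)) ((θ, y), y) (hf θ y hy) (by fun_prop)
    exact (ContDiffAt.fderiv (m := ∞) h contDiffAt_snd (by simp)).continuousAt
  have hcD : Continuous fun θ => fderiv ℝ (f θ) x :=
    continuous_iff_continuousAt.2 fun θ =>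
      ContinuousAt.comp (g := fun p : ℝ × V3 => fderiv ℝ (f p.1) p.2) (f := fun θ => (θ, x))
        (hD θ x hx) (by fun_prop)
  obtain ⟨r, hr, hrU⟩ := Metric.nhds_basis_closedBall.mem_iff.1 (hU.mem_nhds hx)
  obtain ⟨C, hC⟩ := (isCompact_uIcc (a := a) (b := b)).prod (isCompact_closedBall x r)
    |>.exists_bound_of_continuousOn (f := fun p : ℝ × V3 => fderiv ℝ (f p.1) p.2)
      fun p hp => (hD p.1 p.2 (hrU hp.2)).continuousWithinAt
  have key := intervalIntegral.hasFDerivAt_integral_of_dominated_of_fderiv_le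
    (μ := volume) (a := a) (b := b) (F := fun y θ => f θ y)
    (F' := fun y θ => fderiv ℝ (f θ) y) (bound := fun _ => C)
    (Metric.closedBall_mem_nhds x hr)
    (by filter_upwards [hU.mem_nhds hx] with y hy using (hcf y hy).aestronglyMeasurable)
    ((hcf x hx).intervalIntegrable _ _)
    hcD.aestronglyMeasurable
    (.of_forall fun θ hθ y hy => hC (θ, y) ⟨Set.uIoc_subset_uIcc hθ, hy⟩)
    intervalIntegrable_const
    (.of_forall fun θ _ y hy => by
      have h : ContDiffAt ℝ ∞ (f θ) y :=
        ContDiffAt.comp (g := fun p : ℝ × V3 => f p.1 p.2) (f := fun y => (θ, y)) y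
          (hf θ y (hrU hy)) (by fun_prop)
      exact (h.differentiableAt (by simp)).hasFDerivAt)
  rw [pd, key.fderiv, ContinuousLinearMap.intervalIntegral_apply (hcD.intervalIntegrable _ _)]
  rfl

lemma curl_const_mul_intervalIntegral {U : Set V3} (hU : IsOpen U) {w : ℝ → V3 → V3}
    {a b : ℝ} (c : ℝ)
    (hw : ∀ i θ, ∀ x ∈ U, ContDiffAt ℝ ∞ (fun p : ℝ × V3 => w p.1 p.2 i) (θ, x))
    {x : V3} (hx : x ∈ U) (i : Fin 3) :
    curl (fun y i => c * ∫ θ in a..b, w θ y i) x i = c * ∫ θ in a..b, curl (w θ) x i := by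
  have hint (i j : Fin 3) :
      IntervalIntegrable (fun θ => pd j (fun y => w θ y i) x) volume a b :=
    (continuous_iff_continuousAt.2 fun θ =>
      ContinuousAt.comp (g := fun p : ℝ × V3 => pd j (fun y => w p.1 y i) p.2)
        (f := fun θ => (θ, x))
        (contDiffAt_pd_param (f := fun θ y => w θ y i) j (hw i θ x hx)).continuousAt
        (by fun_prop)).intervalIntegrable _ _
  have hpd (i j : Fin 3) : pd j (fun y => c * ∫ θ in a..b, w θ y i) x =
      c * ∫ θ in a..b, pd j (fun y => w θ y i) x := by
    rw [← pd_intervalIntegral hU (f := fun θ y => w θ y i) (hw i) hx j]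
    simp only [pd]
    rw [show (fun y => c * ∫ θ in a..b, w θ y i) = c • fun y => ∫ θ in a..b, w θ y i from rfl,
      fderiv_const_smul_field]
    rfl
  fin_cases i <;>
  · simp only [curl, hpd]
    simp [intervalIntegral.integral_sub, hint, mul_sub]

/-- averaging a vector potential over a volume-preserving symmetry of `B`
yields a vector potential for `B`. -/
theorem averaged_potential_is_potential
    (U : Set V3) (hU : IsOpen U) (Φ : SmoothCircleAction U)
    (hvol : VolumePreserving U Φ.act)
    (A : V3 → V3) (hA : ContDiffOn ℝ (⊤ : ℕ∞) A U)
    (B : V3 → V3) (hB : B = fun x => curl A x)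
    (hPB : PreservesVec U Φ.act B) :
    ∀ x ∈ U, curl (avgCov Φ.act A) x = B x := by
  intro x hx
  subst hB
  have hΦ (θ : ℝ) (y : V3) (hy : y ∈ U) :
      ContDiffAt ℝ ∞ (fun p : ℝ × V3 => Φ.act p.1 p.2) (θ, y) :=
    Φ.smooth.contDiffAt ((isOpen_univ.prod hU).mem_nhds ⟨Set.mem_univ _, hy⟩)
  have hAt (y : V3) (hy : y ∈ U) : ContDiffAt ℝ ∞ A y := hA.contDiffAt (hU.mem_nhds hy)
  have hw (i : Fin 3) (θ : ℝ) (y : V3) (hy : y ∈ U) : ContDiffAt ℝ ∞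
      (fun p : ℝ × V3 => (jacobian (Φ.act p.1) p.2)ᵀ.mulVec (A (Φ.act p.1 p.2)) i) (θ, y) := by
    simp only [Matrix.mulVec, dotProduct, Matrix.transpose_apply, jacobian, Matrix.of_apply]
    refine ContDiffAt.sum fun k _ => ContDiffAt.mul ?_ ?_
    · exact contDiffAt_pd_param (f := fun θ y => Φ.act θ y k) i (contDiffAt_pi.1 (hΦ θ y hy) k)
    · exact ContDiffAt.comp (g := fun z => A z k) (f := fun p : ℝ × V3 => Φ.act p.1 p.2) (θ, y)
        (contDiffAt_pi.1 (hAt _ (Φ.mapsTo θ hy)) k) (hΦ θ y hy)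
  have hcurl (θ : ℝ) :
      curl (fun y => (jacobian (Φ.act θ) y)ᵀ.mulVec (A (Φ.act θ y))) x = curl A x :=
    curl_pullback_of_preserves
      (ContDiffAt.comp (g := fun p : ℝ × V3 => Φ.act p.1 p.2) (f := fun y => (θ, y)) x
        (hΦ θ x hx) (by fun_prop))
      (hAt _ (Φ.mapsTo θ hx)) (hvol θ x hx) (hPB θ x hx)
  ext i
  refine (curl_const_mul_intervalIntegral hU
    (w := fun θ y => (jacobian (Φ.act θ) y)ᵀ.mulVec (A (Φ.act θ y)))
    (1 / (2 * π)) hw hx i).trans ?_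
  simp only [hcurl, intervalIntegral.integral_const, smul_eq_mul, sub_zero]
  field_simp
end
end
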